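/- arXiv:1511.06119 — 6 statements merged into one kernel-verified Lean document; each statement's English description precedes it below -/
import Mathlib

section
/- For every integer k ≥ 2, the rainbow k-connection number of the complete graph on (k+1)^2 vertices equals 2; that is, rc_k(K_{(k+1)^2}) = 2. (Equivalently: there is an edge coloring of K_{(k+1)^2} with 2 colors under which every two distinct vertices are joined by k pairwise internally vertex-disjoint rainbow paths, and no edge coloring with 1 color has this property.) -/
open SimpleGraph

namespace Paper

variable {V : Type*}

/-- The internal vertices of a walk (all vertices except the two endpoints). -/
def internalSupport {G : SimpleGraph V} {u v : V} (p : G.Walk u v) : List V :=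
  p.support.tail.dropLast

/-- A family of walks between two fixed vertices is internally disjoint if the walks
are pairwise distinct and no two of them share an internal vertex. -/
def InternallyDisjoint {G : SimpleGraph V} {u v : V} {k : ℕ}
    (P : Fin k → G.Walk u v) : Prop :=
  Function.Injective P ∧
    ∀ i j, i ≠ j → ∀ w, w ∈ internalSupport (P i) → w ∉ internalSupport (P j)

/-- A rainbow path for an edge coloring: a path whose edges have pairwise distinct colors. -/
def IsRainbowPath {α : Type*} {G : SimpleGraph V} (c : Sym2 V → α)
    {u v : V} (p : G.Walk u v) : Prop :=
  p.IsPath ∧ (p.edges.map c).Nodup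

/-- A vertex-rainbow path: a path whose internal vertices have pairwise distinct colors. -/
def IsVertexRainbowPath {α : Type*} {G : SimpleGraph V} (c : V → α)
    {u v : V} (p : G.Walk u v) : Prop :=
  p.IsPath ∧ ((internalSupport p).map c).Nodup

/-- A total rainbow path: a path whose edges and internal vertices all have
pairwise distinct colors. -/
def IsTotalRainbowPath {α : Type*} {G : SimpleGraph V} (cv : V → α) (ce : Sym2 V → α)
    {u v : V} (p : G.Walk u v) : Prop :=
  p.IsPath ∧ (p.edges.map ce ++ (internalSupport p).map cv).Nodup

/-- `G` is rainbow `k`-connected under the edge coloring `c`: any two distinct vertices are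
joined by `k` pairwise internally vertex-disjoint rainbow paths. -/
def RainbowKConnected {α : Type*} (G : SimpleGraph V) (c : Sym2 V → α) (k : ℕ) : Prop :=
  ∀ u v : V, u ≠ v → ∃ P : Fin k → G.Walk u v,
    (∀ i, IsRainbowPath c (P i)) ∧ InternallyDisjoint P

/-- `G` is rainbow vertex `k`-connected under the vertex coloring `c`. -/
def VertexRainbowKConnected {α : Type*} (G : SimpleGraph V) (c : V → α) (k : ℕ) : Prop :=
  ∀ u v : V, u ≠ v → ∃ P : Fin k → G.Walk u v,
    (∀ i, IsVertexRainbowPath c (P i)) ∧ InternallyDisjoint P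

/-- The pair `u, v` is total rainbow `k`-connected under the total coloring `(cv, ce)`:
`u` and `v` are joined by `k` pairwise internally vertex-disjoint total rainbow paths. -/
def TotalRainbowKConnectedPair {α : Type*} (G : SimpleGraph V)
    (cv : V → α) (ce : Sym2 V → α) (k : ℕ) (u v : V) : Prop :=
  ∃ P : Fin k → G.Walk u v,
    (∀ i, IsTotalRainbowPath cv ce (P i)) ∧ InternallyDisjoint P

/-- `G` is total rainbow `k`-connected under the total coloring `(cv, ce)`. -/
def TotalRainbowKConnected {α : Type*} (G : SimpleGraph V)
    (cv : V → α) (ce : Sym2 V → α) (k : ℕ) : Prop :=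
  ∀ u v : V, u ≠ v → TotalRainbowKConnectedPair G cv ce k u v

/-- The rainbow `k`-connection number: the least number of colors of an edge coloring
making `G` rainbow `k`-connected. -/
noncomputable def rcK (G : SimpleGraph V) (k : ℕ) : ℕ :=
  sInf {t | ∃ c : Sym2 V → Fin t, RainbowKConnected G c k}

/-- The rainbow vertex `k`-connection number. -/
noncomputable def rvcK (G : SimpleGraph V) (k : ℕ) : ℕ :=
  sInf {t | ∃ c : V → Fin t, VertexRainbowKConnected G c k}

/-- The total rainbow `k`-connection number. -/
noncomputable def trcK (G : SimpleGraph V) (k : ℕ) : ℕ :=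
  sInf {t | ∃ (cv : V → Fin t) (ce : Sym2 V → Fin t), TotalRainbowKConnected G cv ce k}

/-- `G` is `l`-connected: it has more than `l` vertices and deleting any set of fewer than
`l` vertices leaves a connected graph. -/
def IsLConnected (G : SimpleGraph V) [Fintype V] (l : ℕ) : Prop :=
  l < Fintype.card V ∧
    ∀ S : Set V, S.ncard < l → (G.induce Sᶜ).Connected

/-- In a complete graph, `k` common neighbours of `u` and `v`, each seeing `u` and `v` in distinct
colors, give together with the edge `uv` a system of `k + 1` disjoint rainbow paths. -/
theorem rainbowKConnected_top_of_injective {α : Type*} (c : Sym2 V → α) (k : ℕ)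
    (h : ∀ u v : V, u ≠ v → ∃ f : Fin k → V, Function.Injective f ∧
      ∀ i, f i ≠ u ∧ f i ≠ v ∧ c s(u, f i) ≠ c s(f i, v)) :
    RainbowKConnected (⊤ : SimpleGraph V) c (k + 1) := by
  intro u v huv
  obtain ⟨f, hf, hfc⟩ := h u v huv
  have h₁ : ∀ i, (⊤ : SimpleGraph V).Adj u (f i) := fun i ↦ (hfc i).1.symm
  have h₂ : ∀ i, (⊤ : SimpleGraph V).Adj (f i) v := fun i ↦ (hfc i).2.1
  have h₀ : (⊤ : SimpleGraph V).Adj u v := huv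
  refine ⟨Fin.cons (.cons h₀ .nil) fun i ↦ .cons (h₁ i) (.cons (h₂ i) .nil), ?_, ?_, ?_⟩
  · intro i
    refine Fin.cases ?_ (fun i ↦ ?_) i
    · simp [IsRainbowPath, huv]
    · have := hfc i
      simp [IsRainbowPath, huv, this.1.symm, this.2.1, this.2.2]
  · rw [Fin.cons_injective_iff]
    refine ⟨?_, fun i j hij ↦ hf ?_⟩
    · rintro ⟨i, hi⟩
      simpa using congrArg Walk.length hi
    · simpa using congrArg Walk.support hij
  · intro i j
    refine Fin.cases ?_ (fun i ↦ ?_) i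
    · simp [internalSupport]
    · refine Fin.cases ?_ (fun j ↦ ?_) j
      · simp [internalSupport]
      · simp [internalSupport, hf.eq_iff]

/-- No graph with two distinct vertices is rainbow `k`-connected, `k ≥ 2`, with a single color. -/
theorem not_rainbowKConnected_of_subsingleton {α : Type*} [Subsingleton α] [Nontrivial V]
    {G : SimpleGraph V} (c : Sym2 V → α) {k : ℕ} (hk : 2 ≤ k) : ¬ RainbowKConnected G c k := by
  intro h
  obtain ⟨u, v, huv⟩ := exists_pair_ne V
  obtain ⟨P, hP, hinj, -⟩ := h u v huv
  have hsupp : ∀ p : G.Walk u v, IsRainbowPath c p → p.support = [u, v] := by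
    rintro p ⟨-, hp⟩
    match p, hp with
    | .nil, _ => exact absurd rfl huv
    | .cons _ .nil, _ => rfl
    | .cons _ (.cons _ _), hp => simp [Subsingleton.elim (c _) (c s(u, v))] at hp
  have := hinj (Walk.ext_support ((hsupp _ (hP ⟨0, by lia⟩)).trans (hsupp _ (hP ⟨1, by lia⟩)).symm))
  simp at this

theorem exists_injective_forall_ne_and_ne (n : ℕ) (a b : Fin (n + 2)) :
    ∃ g : Fin n → Fin (n + 2), Function.Injective g ∧ ∀ i, g i ≠ a ∧ g i ≠ b := by
  obtain ⟨b', hb'⟩ : ∃ b' : Fin (n + 1), b = a ∨ b = a.succAbove b' := by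
    by_cases hab : b = a
    · exact ⟨0, .inl hab⟩
    · obtain ⟨b', rfl⟩ := Fin.exists_succAbove_eq hab
      exact ⟨b', .inr rfl⟩
  refine ⟨fun i ↦ a.succAbove (b'.succAbove i),
    Fin.succAbove_right_injective.comp Fin.succAbove_right_injective,
    fun i ↦ ⟨Fin.succAbove_ne _ _, ?_⟩⟩
  rcases hb' with rfl | rfl
  · exact Fin.succAbove_ne _ _
  · exact fun h ↦ Fin.succAbove_ne _ _ (Fin.succAbove_right_injective h)

/-- The coloring of the pairs of cells of a grid that tells whether two cells share a line. -/
def gridColoring {V ι : Type*} [DecidableEq ι] (e : V → ι × ι) : Sym2 V → Fin 2 :=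
  Sym2.lift ⟨fun x y ↦ if (e x).1 = (e y).1 ∨ (e x).2 = (e y).2 then 0 else 1, fun x y ↦ by
    simp only [eq_comm]⟩

theorem rainbowKConnected_gridColoring (n : ℕ) (e : V ≃ Fin (n + 2) × Fin (n + 2)) :
    RainbowKConnected (⊤ : SimpleGraph V) (gridColoring e) (n + 1) := by
  refine rainbowKConnected_top_of_injective _ n fun u v huv ↦ ?_
  obtain ⟨⟨i, a⟩, rfl⟩ := e.symm.surjective u
  obtain ⟨⟨j, b⟩, rfl⟩ := e.symm.surjective v
  by_cases hij : i = j
  · obtain ⟨g, hg, hne⟩ := exists_injective_forall_ne_and_ne n i j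
    refine ⟨fun x ↦ e.symm (g x, a), fun x y hxy ↦ hg (by simpa using hxy), fun x ↦ ?_⟩
    have := hne x
    simp_all [gridColoring]
  · obtain ⟨g, hg, hne⟩ := exists_injective_forall_ne_and_ne n a b
    refine ⟨fun x ↦ e.symm (i, g x), fun x y hxy ↦ hg (by simpa using hxy), fun x ↦ ?_⟩
    have := hne x
    simp_all [gridColoring]

/-- For every integer `k ≥ 2`, the rainbow `k`-connection number of the
complete graph on `(k+1)^2` vertices equals `2`. -/
theorem rcK_complete_graph (k : ℕ) (hk : 2 ≤ k) :
    rcK (⊤ : SimpleGraph (Fin ((k + 1) ^ 2))) k = 2 := by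
  obtain ⟨n, rfl⟩ : ∃ n, k = n + 1 := ⟨k - 1, by lia⟩
  have e : Fin ((n + 1 + 1) ^ 2) ≃ Fin (n + 2) × Fin (n + 2) :=
    (finCongr (sq _)).trans finProdFinEquiv.symm
  have : Nontrivial (Fin ((n + 1 + 1) ^ 2)) := Fin.nontrivial_iff_two_le.2 (by nlinarith)
  have hmem : 2 ∈ {t | ∃ c : Sym2 (Fin ((n + 1 + 1) ^ 2)) → Fin t, RainbowKConnected ⊤ c (n + 1)} :=
    ⟨gridColoring e, rainbowKConnected_gridColoring n e⟩
  refine le_antisymm (Nat.sInf_le hmem) (le_csInf ⟨2, hmem⟩ ?_)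
  rintro t ⟨c, hc⟩
  by_contra! ht
  have : Subsingleton (Fin t) := Fin.subsingleton_iff_le_one.2 (by lia)
  exact not_rainbowKConnected_of_subsingleton c hk hc

end Paper
end

section
/- Fix k ≥ 1. Let G = (V,E) be a connected graph and let P ⊆ V × V be a set of pairs of distinct nonadjacent vertices of G. Construct G' = (V',E') as follows: for every v ∈ V introduce a set V_v of (k+1)^2 new vertices; for every pair {u,v} of distinct vertices with {u,v} ∉ P introduce a set V_{(u,v)} of (k+1)^2 new vertices; let V' be V together with all these new vertices, and let E' consist of E, the edges v x for every v ∈ V and x ∈ V_v, the edges u x and v x for every pair {u,v} ∉ P and every x ∈ V_{(u,v)}, and all edges between pairs of vertices of V' \ V (so V' \ V spans a complete graph). Then G' admits a total coloring with 3 colors under which every two distinct vertices of G' are joined by k pairwise internally vertex-disjoint total rainbow paths if and only if G admits a total coloring with 3 colors under which, for every pair {u,v} ∈ P, u and v are joined by k pairwise internally vertex-disjoint total rainbow paths. -/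
open SimpleGraph

namespace Paper

variable {V : Type*}

/-- Index set for the `(k+1)²` new vertices of each added clique, viewed as
`{(i,l) : 1 ≤ i,l ≤ k+1}`. -/
abbrev Idx (k : ℕ) := Fin (k + 1) × Fin (k + 1)

/-- Unordered pairs `{u,v}` of distinct vertices with `{u,v} ∉ P`, represented by their
increasingly ordered representative. -/
abbrev PairNotP (V : Type*) [LinearOrder V] (P : Set (Sym2 V)) : Type _ :=
  {q : V × V // q.1 < q.2 ∧ s(q.1, q.2) ∉ P}

/-- The new vertices of the reduction graph `G'`: for each `v ∈ V` a set `V_v` of `(k+1)²`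
vertices, and for each pair `{u,v} ∉ P` of distinct vertices a set `V_{(u,v)}` of `(k+1)²`
vertices. -/
abbrev NewVert (V : Type*) [LinearOrder V] (P : Set (Sym2 V)) (k : ℕ) : Type _ :=
  (V × Idx k) ⊕ (PairNotP V P × Idx k)

/-- The adjacency generating relation of the reduction graph `G'`: edges of `G`; edges
`v x` for `x ∈ V_v`; edges `u x` and `v x` for `x ∈ V_{(u,v)}`, `{u,v} ∉ P`; and all
edges between new vertices. -/
def bigRel {V : Type*} [LinearOrder V] (G : SimpleGraph V) (P : Set (Sym2 V)) (k : ℕ) :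
    (V ⊕ NewVert V P k) → (V ⊕ NewVert V P k) → Prop
  | Sum.inl a, Sum.inl b => G.Adj a b
  | Sum.inl a, Sum.inr (Sum.inl (v, _)) => a = v
  | Sum.inl a, Sum.inr (Sum.inr (q, _)) => a = q.1.1 ∨ a = q.1.2
  | Sum.inr _, Sum.inr _ => True
  | _, _ => False

/-- The reduction graph `G'` of the proof of Lemma 2.2. -/
def bigGraph {V : Type*} [LinearOrder V] (G : SimpleGraph V) (P : Set (Sym2 V)) (k : ℕ) :
    SimpleGraph (V ⊕ NewVert V P k) :=
  SimpleGraph.fromRel (bigRel G P k)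

/-- `m` is the middle vertex of a total rainbow path of length two from `u` to `v`. -/
def IsRainbowMid {W α : Type*} (G : SimpleGraph W) (cv : W → α) (ce : Sym2 W → α)
    (u v m : W) : Prop :=
  G.Adj u m ∧ G.Adj m v ∧ ce s(u, m) ≠ ce s(m, v) ∧ ce s(u, m) ≠ cv m ∧ ce s(m, v) ≠ cv m

namespace IsRainbowMid

variable {W α : Type*} {G : SimpleGraph W} {cv : W → α} {ce : Sym2 W → α} {u v m : W}

/-- The path of length two through a middle vertex. -/
def walk (h : IsRainbowMid G cv ce u v m) : G.Walk u v :=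
  .cons h.1 (.cons h.2.1 .nil)

@[simp]
theorem internalSupport_walk (h : IsRainbowMid G cv ce u v m) : internalSupport h.walk = [m] := by
  simp [walk, internalSupport]

theorem isTotalRainbowPath_walk (h : IsRainbowMid G cv ce u v m) (huv : u ≠ v) :
    IsTotalRainbowPath cv ce h.walk := by
  have h1 := h.1.ne
  have h2 := h.2.1.ne
  obtain ⟨-, -, h3, h4, h5⟩ := id h
  refine ⟨?_, ?_⟩
  · simp [walk, Walk.cons_isPath_iff, h1, h2, huv]
  · rw [internalSupport_walk]
    simp [walk, h3, h4, h5]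

end IsRainbowMid

section Pairs

variable {W α : Type*} {G : SimpleGraph W} {cv : W → α} {ce : Sym2 W → α} {u v : W} {k : ℕ}

theorem TotalRainbowKConnectedPair.of_mids (huv : u ≠ v) (m : Fin k → W)
    (hm : Function.Injective m) (h : ∀ i, IsRainbowMid G cv ce u v (m i)) :
    TotalRainbowKConnectedPair G cv ce k u v := by
  have key : ∀ i j, i ≠ j → ∀ w, w ∈ internalSupport (h i).walk →
      w ∉ internalSupport (h j).walk := by
    intro i j hij w hi hj
    simp only [IsRainbowMid.internalSupport_walk, List.mem_singleton] at hi hj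
    exact hij (hm (hi.symm.trans hj))
  refine ⟨fun i => (h i).walk, fun i => (h i).isTotalRainbowPath_walk huv, fun i j hij => ?_, key⟩
  by_contra hne
  refine key i j hne (m i) (by simp) ?_
  rw [← show (h i).walk = (h j).walk from hij]
  simp

theorem TotalRainbowKConnectedPair.of_adj_of_mids (huv : G.Adj u v) (m : Fin k → W)
    (hm : Function.Injective m) (h : ∀ i, IsRainbowMid G cv ce u v (m i)) :
    TotalRainbowKConnectedPair G cv ce (k + 1) u v := by
  have hnil : internalSupport (Walk.cons huv Walk.nil) = [] := by simp [internalSupport]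
  have hrange : Walk.cons huv Walk.nil ∉ Set.range fun i => (h i).walk := by
    rintro ⟨i, hi⟩
    have := congrArg internalSupport hi
    simp [hnil] at this
  have hinj' : Function.Injective fun i => (h i).walk := by
    intro i j hij
    have := congrArg internalSupport hij
    exact hm (by simpa using this)
  refine ⟨Fin.cons (Walk.cons huv Walk.nil) fun i => (h i).walk, ?_,
    Fin.cons_injective_iff.2 ⟨hrange, hinj'⟩, ?_⟩
  · refine Fin.cases ?_ fun i => ?_
    · refine ⟨by simp [Walk.cons_isPath_iff, huv.ne], ?_⟩
      simp [hnil]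
    · simpa using (h i).isTotalRainbowPath_walk huv.ne
  · refine Fin.cases ?_ fun i => ?_
    · intro j _ w hw
      simp [hnil] at hw
    · refine Fin.cases ?_ fun j => ?_
      · intro _ w _
        simp [hnil]
      · intro hij w hi hj
        simp only [Fin.cons_succ, IsRainbowMid.internalSupport_walk, List.mem_singleton] at hi hj
        exact hij (congrArg Fin.succ (hm (hi.symm.trans hj)))

theorem TotalRainbowKConnectedPair.symm (h : TotalRainbowKConnectedPair G cv ce k u v) :
    TotalRainbowKConnectedPair G cv ce k v u := by
  have hint (p : G.Walk u v) : internalSupport p.reverse = (internalSupport p).reverse := by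
    simp [internalSupport, ← List.tail_reverse, ← List.dropLast_reverse, List.tail_dropLast]
  obtain ⟨Q, hQ, hinj, hdisj⟩ := h
  refine ⟨fun i => (Q i).reverse, fun i => ⟨(hQ i).1.reverse, ?_⟩,
    Walk.reverse_injective.comp hinj, fun i j hij w hi hj => ?_⟩
  · rw [hint, Walk.edges_reverse, List.map_reverse, List.map_reverse]
    exact ((List.reverse_perm _).append (List.reverse_perm _)).nodup_iff.2 (hQ i).2
  · simp only [hint, List.mem_reverse] at hi hj
    exact hdisj i j hij w hi hj

theorem length_internalSupport (p : G.Walk u v) : (internalSupport p).length = p.length - 1 := by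
  simp [internalSupport]

/-- With three colors, a total rainbow path between nonadjacent vertices has length two. -/
theorem IsTotalRainbowPath.exists_mid {cv : W → Fin 3} {ce : Sym2 W → Fin 3} {p : G.Walk u v}
    (hp : IsTotalRainbowPath cv ce p) (huv : u ≠ v) (hadj : ¬G.Adj u v) :
    ∃ m, IsRainbowMid G cv ce u v m ∧ internalSupport p = [m] := by
  obtain ⟨-, hn⟩ := hp
  have hlen := hn.length_le_card
  simp only [List.length_append, List.length_map, Walk.length_edges, length_internalSupport,
    Fintype.card_fin] at hlen
  match p with
  | .nil => exact absurd rfl huv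
  | .cons h .nil => exact absurd h hadj
  | .cons (v := m) h (.cons h' .nil) =>
    refine ⟨m, ?_, by simp [internalSupport]⟩
    simp [internalSupport] at hn
    exact ⟨h, h', hn.1.1, hn.1.2, hn.2⟩
  | .cons _ (.cons _ (.cons _ _)) =>
    simp only [Walk.length_cons] at hlen
    omega

theorem totalRainbowKConnectedPair_iff_mids {cv : W → Fin 3} {ce : Sym2 W → Fin 3}
    (huv : u ≠ v) (hadj : ¬G.Adj u v) :
    TotalRainbowKConnectedPair G cv ce k u v ↔
      ∃ m : Fin k → W, Function.Injective m ∧ ∀ i, IsRainbowMid G cv ce u v (m i) := by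
  constructor
  · rintro ⟨Q, hQ, -, hdisj⟩
    choose m hm hsupp using fun i => (hQ i).exists_mid huv hadj
    refine ⟨m, fun i j hij => ?_, hm⟩
    by_contra hne
    exact hdisj i j hne (m i) (by simp [hsupp]) (by simp [hsupp, hij])
  · rintro ⟨m, hm, h⟩
    exact .of_mids huv m hm h

end Pairs

theorem exists_injective_avoiding (n : ℕ) (a b : Fin (n + 2)) :
    ∃ f : Fin n → Fin (n + 2), Function.Injective f ∧ ∀ i, f i ≠ a ∧ f i ≠ b := by
  by_cases hab : b = a
  · refine ⟨fun i => a.succAbove i.succ,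
      Fin.succAbove_right_injective.comp (Fin.succ_injective n), fun i => ?_⟩
    simp [hab, Fin.succAbove_ne]
  · obtain ⟨c, rfl⟩ := Fin.exists_succAbove_eq hab
    refine ⟨fun i => a.succAbove (c.succAbove i),
      Fin.succAbove_right_injective.comp Fin.succAbove_right_injective, fun i => ⟨?_, ?_⟩⟩
    · exact Fin.succAbove_ne _ _
    · exact fun h => Fin.succAbove_ne _ _ (Fin.succAbove_right_injective h)

section Reduction

variable {V : Type*} [LinearOrder V] {G : SimpleGraph V} {P : Set (Sym2 V)} {k : ℕ}

/-- The new vertex with given index in a given added clique. -/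
def newVert (b : V ⊕ PairNotP V P) (p : Idx k) : NewVert V P k :=
  b.elim (fun v => .inl (v, p)) fun q => .inr (q, p)

/-- The added clique containing a new vertex. -/
def newBlock (x : NewVert V P k) : V ⊕ PairNotP V P := x.map Prod.fst Prod.fst

/-- The index of a new vertex in its added clique. -/
def newIdx (x : NewVert V P k) : Idx k := x.elim Prod.snd Prod.snd

@[simp]
theorem newBlock_newVert (b : V ⊕ PairNotP V P) (p : Idx k) : newBlock (newVert b p) = b := by
  cases b <;> rfl

@[simp]
theorem newIdx_newVert (b : V ⊕ PairNotP V P) (p : Idx k) : newIdx (newVert b p) = p := by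
  cases b <;> rfl

theorem newVert_newBlock_newIdx (x : NewVert V P k) : newVert (newBlock x) (newIdx x) = x := by
  rcases x with x | x <;> rfl

theorem newVert_injective (b : V ⊕ PairNotP V P) :
    Function.Injective (newVert (k := k) b) :=
  fun p q h => by simpa using congrArg newIdx h

@[simp]
theorem bigGraph_adj_inl_inl {a b : V} :
    (bigGraph G P k).Adj (.inl a) (.inl b) ↔ G.Adj a b := by
  simp only [bigGraph, fromRel_adj, bigRel, G.adj_comm b a, or_self, ne_eq, Sum.inl.injEq]
  exact ⟨fun h => h.2, fun h => ⟨h.ne, h⟩⟩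

@[simp]
theorem bigGraph_adj_inr_inr {x y : NewVert V P k} :
    (bigGraph G P k).Adj (.inr x) (.inr y) ↔ x ≠ y := by
  simp [bigGraph, fromRel_adj, bigRel]

@[simp]
theorem bigGraph_adj_inl_newVert_inl {a v : V} {p : Idx k} :
    (bigGraph G P k).Adj (.inl a) (.inr (newVert (.inl v) p)) ↔ a = v := by
  simp [bigGraph, fromRel_adj, bigRel, newVert]

@[simp]
theorem bigGraph_adj_inl_newVert_inr {a : V} {q : PairNotP V P} {p : Idx k} :
    (bigGraph G P k).Adj (.inl a) (.inr (newVert (.inr q) p)) ↔ a = q.1.1 ∨ a = q.1.2 := by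
  simp [bigGraph, fromRel_adj, bigRel, newVert]

/-- A new vertex has no two distinct neighbors `u`, `v` in `V` with `{u, v} ∈ P`. -/
theorem eq_inl_of_adj_of_adj {u v : V} (huv : u ≠ v) (hP : s(u, v) ∈ P) {m : V ⊕ NewVert V P k}
    (hu : (bigGraph G P k).Adj (.inl u) m) (hv : (bigGraph G P k).Adj m (.inl v)) :
    ∃ w, m = .inl w := by
  rcases m with w | x
  · exact ⟨w, rfl⟩
  have hv := hv.symm
  rw [← newVert_newBlock_newIdx x] at hu hv
  generalize newBlock x = b at hu hv
  rcases b with a | q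
  · rw [bigGraph_adj_inl_newVert_inl] at hu hv
    exact absurd (hu.trans hv.symm) huv
  · rw [bigGraph_adj_inl_newVert_inr] at hu hv
    have hq := q.2.2
    rcases hu with rfl | rfl <;> rcases hv with rfl | rfl
    · exact absurd rfl huv
    · exact absurd hP hq
    · exact absurd (Sym2.eq_swap ▸ hP) hq
    · exact absurd rfl huv

/-- The edge color between a vertex of `V` and a new vertex. -/
def attachColor (a : V) : V ⊕ PairNotP V P → Fin 3
  | .inl _ => 0
  | .inr q => if a = q.1.1 then 0 else 1

/-- The edge color between two new vertices. -/
def newColor (x y : NewVert V P k) : Fin 3 :=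
  if newBlock x = newBlock y ∧
    ((newIdx x).1 = (newIdx y).1 ∨ (newIdx x).2 = (newIdx y).2) then 0 else 1

theorem newColor_comm (x y : NewVert V P k) : newColor x y = newColor y x := by
  simp only [newColor, eq_comm]

/-- The vertex coloring of the reduction graph extending a vertex coloring of `G`. -/
def bigVertexColor (P : Set (Sym2 V)) (k : ℕ) (cv : V → Fin 3) : V ⊕ NewVert V P k → Fin 3 :=
  Sum.elim cv fun _ => 2

/-- The edge coloring of the reduction graph extending an edge coloring of `G`. -/
def bigEdgeColor (P : Set (Sym2 V)) (k : ℕ) (ce : Sym2 V → Fin 3) :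
    Sym2 (V ⊕ NewVert V P k) → Fin 3 :=
  Sym2.lift ⟨fun
    | .inl a, .inl b => ce s(a, b)
    | .inl a, .inr x => attachColor a (newBlock x)
    | .inr x, .inl a => attachColor a (newBlock x)
    | .inr x, .inr y => newColor x y, by
    rintro (a | x) (b | y)
    · exact congrArg ce Sym2.eq_swap
    · rfl
    · rfl
    · exact newColor_comm x y⟩

variable {cv : V → Fin 3} {ce : Sym2 V → Fin 3}

theorem isRainbowMid_inl_inl_inl {u v w : V} (h : IsRainbowMid G cv ce u v w) :
    IsRainbowMid (bigGraph G P k) (bigVertexColor P k cv) (bigEdgeColor P k ce)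
      (.inl u) (.inl v) (.inl w) := by
  obtain ⟨h1, h2, h3⟩ := h
  exact ⟨bigGraph_adj_inl_inl.2 h1, bigGraph_adj_inl_inl.2 h2, h3⟩

theorem isRainbowMid_pair (q : PairNotP V P) (p : Idx k) :
    IsRainbowMid (bigGraph G P k) (bigVertexColor P k cv) (bigEdgeColor P k ce)
      (.inl q.1.1) (.inl q.1.2) (.inr (newVert (.inr q) p)) := by
  refine ⟨by simp, SimpleGraph.Adj.symm (by simp), ?_⟩
  simp [bigEdgeColor, bigVertexColor, attachColor, q.2.1.ne']

theorem isRainbowMid_inl_inr {u : V} {x : NewVert V P k} {p : Idx k}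
    (h : newBlock x = .inl u → p.1 ≠ (newIdx x).1 ∧ p.2 ≠ (newIdx x).2) :
    IsRainbowMid (bigGraph G P k) (bigVertexColor P k cv) (bigEdgeColor P k ce)
      (.inl u) (.inr x) (.inr (newVert (.inl u) p)) := by
  refine ⟨by simp, bigGraph_adj_inr_inr.2 ?_, ?_⟩
  · rintro rfl
    simp at h
  · have : newColor (newVert (.inl u) p) x = 1 := by
      simp only [newColor, newBlock_newVert, newIdx_newVert]
      grind
    simp [bigEdgeColor, bigVertexColor, attachColor, this]

theorem isRainbowMid_inr_inr {x x' y : NewVert V P k} (hxy : x ≠ y) (hyx' : y ≠ x')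
    (h : newColor x y = 0) (h' : newColor y x' = 1) :
    IsRainbowMid (bigGraph G P k) (bigVertexColor P k cv) (bigEdgeColor P k ce)
      (.inr x) (.inr x') (.inr y) := by
  refine ⟨bigGraph_adj_inr_inr.2 hxy, bigGraph_adj_inr_inr.2 hyx', ?_⟩
  simp [bigEdgeColor, bigVertexColor, h, h']

theorem totalRainbowKConnectedPair_inl_inl {u v : V} (huv : u < v) (hP : s(u, v) ∉ P) :
    TotalRainbowKConnectedPair (bigGraph G P k) (bigVertexColor P k cv) (bigEdgeColor P k ce) k
      (.inl u) (.inl v) :=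
  .of_mids (by simpa using huv.ne)
    (fun i => .inr (newVert (.inr ⟨(u, v), huv, hP⟩) (i.castSucc, 0)))
    (Sum.inr_injective.comp ((newVert_injective _).comp fun i j h => by simpa using h))
    fun _ => isRainbowMid_pair ⟨(u, v), huv, hP⟩ _

theorem totalRainbowKConnectedPair_inl_inr (hk : 1 ≤ k) (u : V) (x : NewVert V P k) :
    TotalRainbowKConnectedPair (bigGraph G P k) (bigVertexColor P k cv) (bigEdgeColor P k ce) k
      (.inl u) (.inr x) := by
  obtain ⟨n, rfl⟩ := Nat.exists_eq_add_of_le' hk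
  by_cases hx : newBlock x = .inl u
  · refine .of_adj_of_mids (by rw [← newVert_newBlock_newIdx x, hx]; simp)
      (fun i => .inr (newVert (.inl u)
        ((newIdx x).1.succAbove i.succ, (newIdx x).2.succAbove 0)))
      (Sum.inr_injective.comp ((newVert_injective _).comp fun i j h => ?_))
      fun i => isRainbowMid_inl_inr fun _ => ⟨Fin.succAbove_ne _ _, Fin.succAbove_ne _ _⟩
    simpa using h
  · exact .of_mids (by simp) (fun i => .inr (newVert (.inl u) (i.castSucc, 0)))
      (Sum.inr_injective.comp ((newVert_injective _).comp fun i j h => by simpa using h))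
      fun i => isRainbowMid_inl_inr fun h => absurd h hx

theorem totalRainbowKConnectedPair_inr_inr (hk : 1 ≤ k) {x x' : NewVert V P k} (hx : x ≠ x') :
    TotalRainbowKConnectedPair (bigGraph G P k) (bigVertexColor P k cv) (bigEdgeColor P k ce) k
      (.inr x) (.inr x') := by
  obtain ⟨n, rfl⟩ := Nat.exists_eq_add_of_le' hk
  have hadj : (bigGraph G P (n + 1)).Adj (.inr x) (.inr x') := bigGraph_adj_inr_inr.2 hx
  by_cases hrow : newBlock x = newBlock x' ∧ (newIdx x).1 = (newIdx x').1
  · have hcol : (newIdx x).2 ≠ (newIdx x').2 := fun h => hx <| by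
      rw [← newVert_newBlock_newIdx x, ← newVert_newBlock_newIdx x', hrow.1,
        Prod.ext hrow.2 h]
    obtain ⟨f, hf, hne⟩ := exists_injective_avoiding n (newIdx x).1 (newIdx x').1
    refine .of_adj_of_mids hadj (fun i => .inr (newVert (newBlock x) (f i, (newIdx x).2)))
      (Sum.inr_injective.comp ((newVert_injective _).comp fun i j h => hf (by simpa using h)))
      fun i => isRainbowMid_inr_inr (fun h => (hne i).1 ?_) (fun h => (hne i).2 ?_) ?_ ?_
    · rw [h]; simp
    · rw [← h]; simp
    · simp [newColor]
    · simp [newColor, hcol, (hne i).2]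
  · obtain ⟨f, hf, hne⟩ := exists_injective_avoiding n (newIdx x).2 (newIdx x').2
    refine .of_adj_of_mids hadj (fun i => .inr (newVert (newBlock x) ((newIdx x).1, f i)))
      (Sum.inr_injective.comp ((newVert_injective _).comp fun i j h => hf (by simpa using h)))
      fun i => isRainbowMid_inr_inr (fun h => (hne i).1 ?_) (fun h => (hne i).2 ?_) ?_ ?_
    · rw [h]; simp
    · rw [← h]; simp
    · simp [newColor]
    · simpa [newColor, (hne i).2] using hrow

end Reduction

/-- `G'` admits a total coloring with `3` colors making every two distinct
vertices total rainbow `k`-connected if and only if `G` admits a total coloring with `3`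
colors making every pair in `P` total rainbow `k`-connected. -/
theorem bigGraph_trc3_iff {V : Type*} [LinearOrder V] (k : ℕ) (hk : 1 ≤ k)
    (G : SimpleGraph V) (hG : G.Connected) (P : Set (Sym2 V))
    (hP : ∀ u v : V, s(u, v) ∈ P → u ≠ v ∧ ¬G.Adj u v) :
    (∃ (cv' : (V ⊕ NewVert V P k) → Fin 3) (ce' : Sym2 (V ⊕ NewVert V P k) → Fin 3),
        TotalRainbowKConnected (bigGraph G P k) cv' ce' k) ↔
    (∃ (cv : V → Fin 3) (ce : Sym2 V → Fin 3),
        ∀ u v : V, s(u, v) ∈ P → TotalRainbowKConnectedPair G cv ce k u v) := by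
  constructor
  · rintro ⟨cv', ce', h⟩
    refine ⟨cv' ∘ Sum.inl, ce' ∘ Sym2.map Sum.inl, fun u v huv => ?_⟩
    obtain ⟨hne, hadj⟩ := hP u v huv
    obtain ⟨m, hm, hmid⟩ := (totalRainbowKConnectedPair_iff_mids (by simpa using hne)
      (by simpa using hadj)).1 (h (.inl u) (.inl v) (by simpa using hne))
    choose w hw using fun i => eq_inl_of_adj_of_adj hne huv (hmid i).1 (hmid i).2.1
    refine .of_mids hne w (fun i j hij => hm (by rw [hw, hw, hij])) fun i => ?_
    obtain ⟨h1, h2, h3⟩ := hw i ▸ hmid i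
    exact ⟨bigGraph_adj_inl_inl.1 h1, bigGraph_adj_inl_inl.1 h2, h3⟩
  · rintro ⟨cv, ce, h⟩
    refine ⟨bigVertexColor P k cv, bigEdgeColor P k ce, ?_⟩
    rintro (u | x) (v | y) hne
    · have huv : u ≠ v := by simpa using hne
      by_cases hmem : s(u, v) ∈ P
      · obtain ⟨m, hm, hmid⟩ :=
          (totalRainbowKConnectedPair_iff_mids huv (hP u v hmem).2).1 (h u v hmem)
        exact .of_mids hne (Sum.inl ∘ m) (Sum.inl_injective.comp hm)
          fun i => isRainbowMid_inl_inl_inl (hmid i)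
      · rcases huv.lt_or_gt with hlt | hgt
        · exact totalRainbowKConnectedPair_inl_inl hlt hmem
        · exact (totalRainbowKConnectedPair_inl_inl hgt (Sym2.eq_swap ▸ hmem)).symm
    · exact totalRainbowKConnectedPair_inl_inr hk u y
    · exact (totalRainbowKConnectedPair_inl_inr hk v x).symm
    · exact totalRainbowKConnectedPair_inr_inr hk (by simpa using hne)

end Paper
end

section
/- Fix k ≥ 1. Let φ = c_1 ∧ c_2 ∧ … ∧ c_m be a 3-CNF formula over variables x_1,…,x_n in which no clause contains both a variable and its negation and no clause contains a variable twice. Construct the graph G with vertex set {c_t : t ∈ [m]} ∪ {c^j_t : t ∈ [m], 2 ≤ j ≤ k} ∪ {x_i : i ∈ [n]} ∪ {s} and edge set consisting of: c_t x_i whenever variable x_i occurs (positively or negatively) in clause c_t; s x_i for all i ∈ [n]; and s c^j_t and c^j_t c_t for all t ∈ [m] and 2 ≤ j ≤ k. Let Q = {{s, c_t} : t ∈ [m]}, and define the partial 2-edge-coloring χ̂ on the edges c_t x_i by χ̂(c_t x_i) = 0 if x_i occurs positively in c_t and χ̂(c_t x_i) = 1 if x_i occurs negatively in c_t. Then χ̂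 can be extended to a total coloring χ of G with colors {0,1,2} making every pair in Q total rainbow k-connected and satisfying χ(e) ∉ {χ(u), χ(v)} for every precolored edge e = uv, if and only if φ is satisfiable. -/
open SimpleGraph

namespace Paper

variable {V : Type*}

/-- The vertices of the graph of the 3-SAT reduction (Lemma 2.4): the root `s`, a vertex
`x_i` for each variable, a vertex `c_t` for each clause, and for each clause the vertices
`c^j_t`, `2 ≤ j ≤ k` (here `k - 1` of them). -/
inductive SatV (n m k : ℕ) : Type
  | s : SatV n m k
  | var (i : Fin n) : SatV n m k
  | clause (t : Fin m) : SatV n m k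
  | cj (t : Fin m) (j : Fin (k - 1)) : SatV n m k

/-- The adjacency generating relation for the 3-SAT reduction graph, given the clauses
`C : Fin m → Finset (Fin n × Bool)` (a literal `(i, b)` is the variable `x_i`, positive
iff `b = true`): edges `c_t x_i` whenever `x_i` occurs in `c_t`, edges `s x_i`, and edges
`s c^j_t` and `c^j_t c_t`. -/
def satRel {n m k : ℕ} (C : Fin m → Finset (Fin n × Bool)) :
    SatV n m k → SatV n m k → Prop
  | SatV.clause t, SatV.var i => ∃ b, (i, b) ∈ C t
  | SatV.s, SatV.var _ => True
  | SatV.s, SatV.cj _ _ => True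
  | SatV.cj t _, SatV.clause t' => t = t'
  | _, _ => False

/-- The graph `G` of the 3-SAT reduction (Lemma 2.4). -/
def satGraph {n m k : ℕ} (C : Fin m → Finset (Fin n × Bool)) :
    SimpleGraph (SatV n m k) :=
  SimpleGraph.fromRel (satRel C)

section Midpoint

variable {α : Type*} {G : SimpleGraph V} {cv : V → α} {ce : Sym2 V → α} {u v w : V}

theorem internalSupport_cons_cons_nil (h : G.Adj u v) (h' : G.Adj v w) :
    internalSupport (.cons h (.cons h' .nil)) = [v] := rfl

theorem isTotalRainbowPath_cons_cons_nil_iff (h : G.Adj u v) (h' : G.Adj v w) (huw : u ≠ w) :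
    IsTotalRainbowPath cv ce (.cons h (.cons h' .nil)) ↔
      ce s(u, v) ≠ ce s(v, w) ∧ ce s(u, v) ≠ cv v ∧ ce s(v, w) ≠ cv v := by
  have h1 := h.ne
  have h2 := h'.ne
  simp [IsTotalRainbowPath, internalSupport, Walk.cons_isPath_iff, and_assoc, *]

/-- With three colors, total rainbow paths between nonadjacent vertices have length two. -/
theorem IsTotalRainbowPath.exists_eq_cons_cons_nil {cv : V → Fin 3} {ce : Sym2 V → Fin 3}
    {p : G.Walk u w} (hp : IsTotalRainbowPath cv ce p) (huw : u ≠ w) (hadj : ¬ G.Adj u w) :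
    ∃ (v : V) (h : G.Adj u v) (h' : G.Adj v w), p = .cons h (.cons h' .nil) := by
  have hlen := hp.2.length_le_card
  match p with
  | .nil => exact absurd rfl huw
  | .cons h .nil => exact absurd h hadj
  | .cons h (.cons h' .nil) => exact ⟨_, h, h', rfl⟩
  | .cons _ (.cons _ (.cons _ _)) =>
    simp [internalSupport] at hlen
    omega

end Midpoint

section SatGraph

variable {n m k : ℕ} {C : Fin m → Finset (Fin n × Bool)}

theorem satGraph_not_adj_s_clause (t : Fin m) :
    ¬ (satGraph (k := k) C).Adj .s (.clause t) := by
  simp [satGraph, satRel]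

theorem satGraph_adj_s_var (i : Fin n) : (satGraph (k := k) C).Adj .s (.var i) := by
  simp [satGraph, satRel]

theorem satGraph_adj_s_cj (t : Fin m) (j : Fin (k - 1)) :
    (satGraph C).Adj .s (.cj t j) := by
  simp [satGraph, satRel]

theorem satGraph_adj_cj_clause_iff {t t' : Fin m} {j : Fin (k - 1)} :
    (satGraph C).Adj (.cj t j) (.clause t') ↔ t = t' := by
  simp [satGraph, satRel]

theorem satGraph_adj_var_clause_iff {i : Fin n} {t : Fin m} :
    (satGraph (k := k) C).Adj (.var i) (.clause t) ↔ ∃ b, (i, b) ∈ C t := by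
  simp [satGraph, satRel]

/-- Since only `k - 1` of the vertices `c^j_t` are available, one of the `k` total rainbow
paths from `s` to `c_t` runs through a variable of the clause. -/
theorem exists_var_of_totalRainbowKConnectedPair (hk : 1 ≤ k)
    {cv : SatV n m k → Fin 3} {ce : Sym2 (SatV n m k) → Fin 3} {t : Fin m}
    (h : TotalRainbowKConnectedPair (satGraph C) cv ce k .s (.clause t)) :
    ∃ i b, (i, b) ∈ C t ∧
      ce s(.s, .var i) ≠ ce s(.var i, .clause t) ∧ ce s(.s, .var i) ≠ cv (.var i) ∧
      ce s(.var i, .clause t) ≠ cv (.var i) := by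
  obtain ⟨P, hP, hinj, -⟩ := h
  have hmid := fun a => (hP a).exists_eq_cons_cons_nil (by simp) (satGraph_not_adj_s_clause t)
  choose v hv hv' hPv using hmid
  have v_inj : Function.Injective v := by
    intro a b hab
    apply hinj
    apply Walk.ext_support
    rw [hPv a, hPv b]
    simp [hab]
  by_cases hvar : ∃ a i, v a = .var i
  · obtain ⟨a, i, hai⟩ := hvar
    have hrain := hP a
    rw [hPv a, isTotalRainbowPath_cons_cons_nil_iff _ _ (by simp), hai] at hrain
    have hadj := hv' a
    rw [hai, satGraph_adj_var_clause_iff] at hadj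
    obtain ⟨b, hb⟩ := hadj
    exact ⟨i, b, hb, hrain⟩
  · have hcj : ∀ a, ∃ j, v a = .cj t j := by
      intro a
      have h1 := hv a
      have h2 := hv' a
      cases hva : v a with
      | s => exact absurd hva h1.ne'
      | var i => exact absurd ⟨a, i, hva⟩ hvar
      | clause t' => exact absurd (hva ▸ h1) (satGraph_not_adj_s_clause t')
      | cj t' j =>
        rw [hva, satGraph_adj_cj_clause_iff] at h2
        exact ⟨j, by rw [h2]⟩
    choose j hj using hcj
    have j_inj : Function.Injective j := fun a b hab => v_inj (by rw [hj a, hj b, hab])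
    have hcard := Fintype.card_le_of_injective j j_inj
    simp only [Fintype.card_fin] at hcard
    omega

/-- If `s` reaches `c_t` by a total rainbow path through a variable `x_i` and by one through
each `c^j_t`, these `k` paths are internally disjoint. -/
theorem totalRainbowKConnectedPair_of_midpoints (hk : 1 ≤ k) {α : Type*}
    {cv : SatV n m k → α} {ce : Sym2 (SatV n m k) → α} {t : Fin m} {i : Fin n} {b : Bool}
    (hi : (i, b) ∈ C t)
    (hvar : ce s(.s, .var i) ≠ ce s(.var i, .clause t) ∧ ce s(.s, .var i) ≠ cv (.var i) ∧
      ce s(.var i, .clause t) ≠ cv (.var i))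
    (hcj : ∀ j, ce s(.s, .cj t j) ≠ ce s(.cj t j, .clause t) ∧
      ce s(.s, .cj t j) ≠ cv (.cj t j) ∧ ce s(.cj t j, .clause t) ≠ cv (.cj t j)) :
    TotalRainbowKConnectedPair (satGraph C) cv ce k .s (.clause t) := by
  obtain ⟨k, rfl⟩ := Nat.exists_eq_add_of_le' hk
  let v : Fin (k + 1) → SatV n m (k + 1) := Fin.cons (.var i) fun j => .cj t j
  have v_inj : Function.Injective v := by
    refine Fin.cons_injective_iff.2 ⟨by simp, fun j j' h => ?_⟩
    simpa using h
  have hv : ∀ a, (satGraph C).Adj .s (v a) :=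
    Fin.cases (satGraph_adj_s_var i) fun j => satGraph_adj_s_cj (k := k + 1) t j
  have hv' : ∀ a, (satGraph C).Adj (v a) (.clause t) :=
    Fin.cases (satGraph_adj_var_clause_iff.2 ⟨b, hi⟩) fun _ => satGraph_adj_cj_clause_iff.2 rfl
  have hdisj : ∀ a a', a ≠ a' → ∀ w,
      w ∈ internalSupport (.cons (hv a) (.cons (hv' a) .nil)) →
      w ∉ internalSupport (.cons (hv a') (.cons (hv' a') .nil)) := by
    intro a a' haa' w hw hw'
    rw [internalSupport_cons_cons_nil, List.mem_singleton] at hw hw'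
    exact haa' (v_inj (hw.symm.trans hw'))
  refine ⟨fun a => .cons (hv a) (.cons (hv' a) .nil), fun a => ?_, fun a a' h => ?_, hdisj⟩
  · rw [isTotalRainbowPath_cons_cons_nil_iff _ _ (by simp)]
    exact Fin.cases (motive := fun a => ce s(.s, v a) ≠ ce s(v a, .clause t) ∧
      ce s(.s, v a) ≠ cv (v a) ∧ ce s(v a, .clause t) ≠ cv (v a)) hvar hcj a
  · have := congrArg internalSupport h
    simp only [internalSupport_cons_cons_nil, List.cons.injEq, and_true] at this
    exact v_inj this

/-- The edge coloring of the reduction graph induced by a truth assignment `a`, on ordered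
pairs; it is symmetrized in `assignmentEdgeColor`. -/
def assignmentPairColor (C : Fin m → Finset (Fin n × Bool)) (a : Fin n → Bool) :
    SatV n m k → SatV n m k → Fin 3
  | .clause t, .var i => if (i, true) ∈ C t then 0 else 1
  | .s, .var i => if a i then 1 else 0
  | .cj _ _, .clause _ => 1
  | _, _ => 0

/-- The edge coloring of the reduction graph induced by a truth assignment `a`. -/
def assignmentEdgeColor (C : Fin m → Finset (Fin n × Bool)) (a : Fin n → Bool) :
    Sym2 (SatV n m k) → Fin 3 :=
  Sym2.lift ⟨fun u v => max (assignmentPairColor C a u v) (assignmentPairColor C a v u),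
    fun _ _ => max_comm _ _⟩

theorem assignmentEdgeColor_clause_var
    (hvar : ∀ t, ∀ p ∈ C t, ∀ q ∈ C t, p.1 = q.1 → p = q) (a : Fin n → Bool)
    {t : Fin m} {i : Fin n} {b : Bool} (h : (i, b) ∈ C t) :
    assignmentEdgeColor (k := k) C a s(.clause t, .var i) = if b then 0 else 1 := by
  cases b
  · have : (i, true) ∉ C t := fun h' => by simpa using hvar t _ h _ h' rfl
    simp [assignmentEdgeColor, assignmentPairColor, this]
  · simp [assignmentEdgeColor, assignmentPairColor, h]

theorem assignmentEdgeColor_s_var (a : Fin n → Bool) (i : Fin n) :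
    assignmentEdgeColor (k := k) C a s(.s, .var i) = if a i then 1 else 0 := by
  simp [assignmentEdgeColor, assignmentPairColor]

theorem assignmentEdgeColor_s_cj (a : Fin n → Bool) (t : Fin m) (j : Fin (k - 1)) :
    assignmentEdgeColor C a s(.s, .cj t j) = 0 := by
  simp [assignmentEdgeColor, assignmentPairColor]

theorem assignmentEdgeColor_cj_clause (a : Fin n → Bool) (t t' : Fin m) (j : Fin (k - 1)) :
    assignmentEdgeColor C a s(.cj t j, .clause t') = 1 := by
  simp [assignmentEdgeColor, assignmentPairColor]

end SatGraph

/-- (Lemma 2.4: 3-SAT reduces to Problem 3.) Let `φ` be a 3-CNF formula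
with clauses `C t`, each with at most `3` literals and no variable occurring twice. Then
the partial 2-edge-coloring `χ̂` (precoloring `c_t x_i` with `0` for positive and `1` for
negative occurrences) extends to a total coloring `χ` of the reduction graph with colors
`{0,1,2}` making every pair `{s, c_t}` total rainbow `k`-connected and satisfying
`χ(e) ∉ {χ(u), χ(v)}` for every precolored edge `e = uv`, if and only if `φ` is
satisfiable. -/
theorem satGraph_iff_satisfiable (n m k : ℕ) (hk : 1 ≤ k)
    (C : Fin m → Finset (Fin n × Bool))
    (hcard : ∀ t, (C t).card ≤ 3)
    (hvar : ∀ t, ∀ p ∈ C t, ∀ q ∈ C t, p.1 = q.1 → p = q) :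
    (∃ (cv : SatV n m k → Fin 3) (ce : Sym2 (SatV n m k) → Fin 3),
        (∀ (t : Fin m) (i : Fin n) (b : Bool), (i, b) ∈ C t →
          ce s(SatV.clause t, SatV.var i) = if b then 0 else 1) ∧
        (∀ (t : Fin m) (i : Fin n) (b : Bool), (i, b) ∈ C t →
          ce s(SatV.clause t, SatV.var i) ≠ cv (SatV.clause t) ∧
          ce s(SatV.clause t, SatV.var i) ≠ cv (SatV.var i)) ∧
        (∀ t : Fin m, TotalRainbowKConnectedPair (satGraph C) cv ce k
          SatV.s (SatV.clause t))) ↔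
    (∃ a : Fin n → Bool, ∀ t : Fin m, ∃ l ∈ C t, a l.1 = l.2) := by
  constructor
  · rintro ⟨cv, ce, hpre, -, hconn⟩
    refine ⟨fun i => decide (ce s(.s, .var i) ≠ 0 ∧ cv (.var i) ≠ 0), fun t => ?_⟩
    obtain ⟨i, b, hib, h1, h2, h3⟩ := exists_var_of_totalRainbowKConnectedPair hk (hconn t)
    refine ⟨(i, b), hib, ?_⟩
    rw [Sym2.eq_swap (a := SatV.var i), hpre t i b hib] at h1 h3
    dsimp only
    generalize ce s(.s, .var i) = x at *
    generalize cv (.var i) = y at *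
    clear hpre hconn hib
    revert x y b
    decide
  · rintro ⟨a, ha⟩
    have hpre := fun t i b =>
      assignmentEdgeColor_clause_var (k := k) (t := t) (i := i) (b := b) hvar a
    refine ⟨fun _ => 2, assignmentEdgeColor C a, hpre, fun t i b h => ?_, fun t => ?_⟩
    · rw [hpre t i b h]
      cases b <;> simp
    · obtain ⟨⟨i, b⟩, hib, hab⟩ := ha t
      refine totalRainbowKConnectedPair_of_midpoints hk hib ?_ fun j => ?_
      · rw [Sym2.eq_swap (a := SatV.var i), hpre t i b hib, assignmentEdgeColor_s_var]
        dsimp only at hab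
        rw [hab]
        cases b <;> decide
      · rw [assignmentEdgeColor_s_cj, assignmentEdgeColor_cj_clause]
        decide

end Paper
end

section
/- Fix k ≥ 1 and let φ, G, Q and χ̂ be as in the 3-SAT reduction construction (vertices c_t, c^j_t for 2 ≤ j ≤ k, x_i, s; edges c_t x_i for occurrences of x_i in clause c_t, s x_i, s c^j_t and c^j_t c_t; Q = {{s,c_t} : t ∈ [m]}; χ̂(c_t x_i) = 0 for positive occurrences and 1 for negative occurrences). Suppose φ is satisfiable and fix a satisfying truth assignment a : {x_1,…,x_n} → {0,1}. Define the total coloring χ of G with colors {0,1,2} by: χ(v) = 2 for every vertex v; χ agrees with χ̂ on the precolored edges; χ(s c^j_t) = 0 and χ(c^j_t c_t) = 1 for all t ∈ [m] and 2 ≤ j ≤ k; and χ(s x_i) = a(x_i) for all i ∈ [n]. Then χ makes every pair in Q total rainbow k-connected, and χ(e) ∉ {χ(u), χ(v)} for every precolored edge e = uv. -/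
open SimpleGraph

namespace Paper

variable {V : Type*}

/-- A family of distinct common neighbours `w i` of `u ≠ v` makes the pair `u, v` total rainbow
`k`-connected, provided that every path `u, w i, v` carries three distinct colors. -/
theorem totalRainbowKConnectedPair_of_commonNeighbors {α : Type*} {G : SimpleGraph V}
    {cv : V → α} {ce : Sym2 V → α} {k : ℕ} {u v : V} (huv : u ≠ v) {w : Fin k → V}
    (hw : Function.Injective w) (hu : ∀ i, G.Adj u (w i)) (hv : ∀ i, G.Adj (w i) v)
    (hce : ∀ i, ce s(u, w i) ≠ ce s(w i, v)) (hcu : ∀ i, ce s(u, w i) ≠ cv (w i))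
    (hcv : ∀ i, ce s(w i, v) ≠ cv (w i)) :
    TotalRainbowKConnectedPair G cv ce k u v := by
  have hint (i : Fin k) :
      internalSupport (Walk.cons (hu i) (Walk.cons (hv i) Walk.nil)) = [w i] := rfl
  refine ⟨fun i => Walk.cons (hu i) (Walk.cons (hv i) Walk.nil), fun i => ⟨?_, ?_⟩,
    fun i j hij => ?_, fun i j hij x hxi hxj => hij (hw ?_)⟩
  · simp [(hu i).ne, (hv i).ne, huv]
  · simp [hint, hce i, hcu i, hcv i]
  · have h := congrArg internalSupport hij
    rw [hint, hint] at h
    exact hw (List.singleton_inj.mp h)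
  · rw [hint, List.mem_singleton] at hxi hxj
    exact hxi.symm.trans hxj

/-- (Forward direction of Lemma 2.4.) Suppose `φ` is satisfiable with a
satisfying assignment `a`. Define the total coloring `χ = (cv, ce)` of the reduction graph
by: every vertex gets color `2`; `χ` agrees with `χ̂` on the precolored edges `c_t x_i`;
`χ(s c^j_t) = 0` and `χ(c^j_t c_t) = 1`; and `χ(s x_i)` is the truth value `a(x_i)`
(coded as `1` for true, `0` for false). Then `χ` makes every pair `{s, c_t}` total
rainbow `k`-connected, and `χ(e) ∉ {χ(u), χ(v)}` for every precolored edge `e = uv`. -/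
theorem satGraph_forward (n m k : ℕ) (hk : 1 ≤ k)
    (C : Fin m → Finset (Fin n × Bool))
    (hcard : ∀ t, (C t).card ≤ 3)
    (hvar : ∀ t, ∀ p ∈ C t, ∀ q ∈ C t, p.1 = q.1 → p = q)
    (a : Fin n → Bool) (ha : ∀ t : Fin m, ∃ l ∈ C t, a l.1 = l.2)
    (cv : SatV n m k → Fin 3) (ce : Sym2 (SatV n m k) → Fin 3)
    (hcv : ∀ x, cv x = 2)
    (hce₁ : ∀ (t : Fin m) (i : Fin n) (b : Bool), (i, b) ∈ C t →
      ce s(SatV.clause t, SatV.var i) = if b then 0 else 1)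
    (hce₂ : ∀ (t : Fin m) (j : Fin (k - 1)), ce s(SatV.s, SatV.cj t j) = 0)
    (hce₃ : ∀ (t : Fin m) (j : Fin (k - 1)), ce s(SatV.cj t j, SatV.clause t) = 1)
    (hce₄ : ∀ i : Fin n, ce s(SatV.s, SatV.var i) = if a i then 1 else 0) :
    (∀ t : Fin m, TotalRainbowKConnectedPair (satGraph C) cv ce k
      SatV.s (SatV.clause t)) ∧
    (∀ (t : Fin m) (i : Fin n) (b : Bool), (i, b) ∈ C t →
      ce s(SatV.clause t, SatV.var i) ≠ cv (SatV.clause t) ∧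
      ce s(SatV.clause t, SatV.var i) ≠ cv (SatV.var i)) := by
  refine ⟨fun t => ?_, fun t i b h => ?_⟩
  · obtain ⟨k, rfl⟩ : ∃ l, k = l + 1 := ⟨k - 1, by omega⟩
    obtain ⟨⟨i, b⟩, hl, hab⟩ := ha t
    have hclause := hce₁ t i b hl
    rw [Sym2.eq_swap] at hclause
    refine totalRainbowKConnectedPair_of_commonNeighbors (by simp)
      (w := Fin.cons (SatV.var i) fun j : Fin k => SatV.cj t j) ?_ ?_ ?_ ?_ ?_ ?_
    · refine Fin.cons_injective_iff.mpr ⟨by simp, fun j j' h => ?_⟩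
      injection h
    all_goals refine Fin.cases ?_ fun j => ?_
    all_goals simp only [Fin.cons_zero, Fin.cons_succ]
    · simp [satGraph, satRel]
    · simp [satGraph, satRel]
    · simpa [satGraph, satRel] using (⟨b, hl⟩ : ∃ b, (i, b) ∈ C t)
    · simp [satGraph, satRel]
    · rw [hce₄, hclause, show a i = b from hab]
      cases b <;> simp
    · rw [hce₂ t j, hce₃ t j]
      decide
    · rw [hce₄, hcv]
      split <;> decide
    · rw [hce₂ t j, hcv]
      decide
    · rw [hclause, hcv]
      split <;> decide
    · rw [hce₃ t j, hcv]
      decide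
  · rw [hce₁ t i b h, hcv, hcv]
    cases b <;> decide

end Paper
end

section
/- Fix k ≥ 1 and let φ, G, Q and χ̂ be as in the 3-SAT reduction construction (vertices c_t, c^j_t for 2 ≤ j ≤ k, x_i, s; edges c_t x_i for occurrences of x_i in clause c_t, s x_i, s c^j_t and c^j_t c_t; Q = {{s,c_t} : t ∈ [m]}; χ̂(c_t x_i) = 0 for positive occurrences and 1 for negative occurrences). Suppose χ is a total coloring of G with colors {0,1,2} extending χ̂ that makes every pair in Q total rainbow k-connected and satisfies χ(e) ∉ {χ(u), χ(v)} for every precolored edge e = uv. Then φ is satisfiable; indeed, for every clause c_t there is a total rainbow path s x_i c_t through some variable vertex x_i, and assigning each such x_i the truth value in {χ(s x_i), χ(x_i)} ∩ {0,1} (extending arbitrarily to the other variables) satisfies φ. -/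
open SimpleGraph

namespace Paper

variable {V : Type*}

variable {α : Type*}

/-- A total rainbow path using colors from a finite type has at most half as many edges,
rounded up, as there are colors. -/
theorem IsTotalRainbowPath.two_mul_length_le [Fintype α] {G : SimpleGraph V} {cv : V → α}
    {ce : Sym2 V → α} {u v : V} {p : G.Walk u v} (hp : IsTotalRainbowPath cv ce p) :
    2 * p.length ≤ Fintype.card α + 1 := by
  have h := hp.2.length_le_card
  simp only [List.length_append, List.length_map, Walk.length_edges, internalSupport,
    List.length_dropLast, List.length_tail, Walk.length_support] at h
  omega

/-- With three colors, a total rainbow path between distinct nonadjacent vertices has exactly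
one internal vertex. -/
theorem IsTotalRainbowPath.exists_support_eq {G : SimpleGraph V} {cv : V → Fin 3}
    {ce : Sym2 V → Fin 3} {u v : V} {p : G.Walk u v} (hp : IsTotalRainbowPath cv ce p)
    (huv : u ≠ v) (hadj : ¬ G.Adj u v) :
    ∃ w, G.Adj u w ∧ G.Adj w v ∧ p.support = [u, w, v] := by
  have h := hp.two_mul_length_le
  rw [Fintype.card_fin] at h
  match p with
  | .nil => exact absurd rfl huv
  | .cons h₁ .nil => exact absurd h₁ hadj
  | .cons h₁ (.cons h₂ .nil) => exact ⟨_, h₁, h₂, rfl⟩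
  | .cons _ (.cons _ (.cons _ q)) =>
    simp only [Walk.length_cons] at h
    omega

/-- The colors along a total rainbow path with exactly one internal vertex are distinct. -/
theorem IsTotalRainbowPath.colors_ne {G : SimpleGraph V} {cv : V → α} {ce : Sym2 V → α}
    {u v w : V} {p : G.Walk u v} (hp : IsTotalRainbowPath cv ce p)
    (hs : p.support = [u, w, v]) :
    ce s(u, w) ≠ ce s(w, v) ∧ ce s(u, w) ≠ cv w ∧ ce s(w, v) ≠ cv w := by
  obtain ⟨-, h⟩ := hp
  rw [internalSupport, hs] at h
  match p with
  | .nil => simp at hs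
  | .cons _ .nil => simp at hs
  | .cons _ (.cons _ .nil) =>
    obtain rfl : _ = w := by simpa using hs
    simpa [and_assoc] using h
  | .cons _ (.cons _ (.cons _ q)) =>
    have := congrArg List.length hs
    simp at this

/-- If `s` and `c_t` are total rainbow `k`-connected in three colors, then some total rainbow
path between them runs through a variable vertex: only `k - 1` of the `k` disjoint paths can
run through the vertices `c^j_t`. -/
theorem exists_isTotalRainbowPath_var {n m k : ℕ} (hk : 1 ≤ k)
    {C : Fin m → Finset (Fin n × Bool)} {cv : SatV n m k → Fin 3}
    {ce : Sym2 (SatV n m k) → Fin 3} {t : Fin m}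
    (hQ : TotalRainbowKConnectedPair (satGraph C) cv ce k SatV.s (SatV.clause t)) :
    ∃ (i : Fin n) (b : Bool), (i, b) ∈ C t ∧
      ∃ p : (satGraph C).Walk SatV.s (SatV.clause t),
        p.support = [SatV.s, SatV.var i, SatV.clause t] ∧ IsTotalRainbowPath cv ce p := by
  obtain ⟨P, hP, -, hdisj⟩ := hQ
  by_contra hcon
  have key : ∀ r, ∃ j : Fin (k - 1), (P r).support = [SatV.s, SatV.cj t j, SatV.clause t] := by
    intro r
    obtain ⟨w, h₁, h₂, hs⟩ := (hP r).exists_support_eq (by simp)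
      (by simp [satGraph, satRel])
    cases w with
    | s => exact absurd h₁ (SimpleGraph.irrefl _)
    | clause t' => simp [satGraph, satRel] at h₁
    | var i =>
      obtain ⟨b, hb⟩ : ∃ b, (i, b) ∈ C t := by simpa [satGraph, satRel] using h₂
      exact absurd ⟨i, b, hb, P r, hs, hP r⟩ hcon
    | cj t' j =>
      obtain rfl : t' = t := by simpa [satGraph, satRel] using h₂
      exact ⟨j, hs⟩
  choose j hj using key
  have hinj : Function.Injective j := by
    intro r r' h
    by_contra hne
    refine hdisj r r' hne (SatV.cj t (j r)) ?_ ?_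
    · simp [internalSupport, hj]
    · simp [internalSupport, hj, h]
  have := Fintype.card_le_of_injective j hinj
  simp only [Fintype.card_fin] at this
  omega

/-- (Backward direction of Lemma 2.4.) Suppose `χ = (cv, ce)` is a total
coloring of the reduction graph with colors `{0,1,2}` extending the precoloring `χ̂` that
makes every pair `{s, c_t}` total rainbow `k`-connected and satisfies
`χ(e) ∉ {χ(u), χ(v)}` for every precolored edge `e = uv`. Then for every clause `c_t`
there is a total rainbow path `s x_i c_t` through some variable vertex `x_i`, and `φ` is
satisfiable: there is a satisfying assignment that, for each clause, assigns a literal of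
the clause through whose variable such a total rainbow path runs its satisfying value. -/
theorem satGraph_backward (n m k : ℕ) (hk : 1 ≤ k)
    (C : Fin m → Finset (Fin n × Bool))
    (hcard : ∀ t, (C t).card ≤ 3)
    (hvar : ∀ t, ∀ p ∈ C t, ∀ q ∈ C t, p.1 = q.1 → p = q)
    (cv : SatV n m k → Fin 3) (ce : Sym2 (SatV n m k) → Fin 3)
    (hce₁ : ∀ (t : Fin m) (i : Fin n) (b : Bool), (i, b) ∈ C t →
      ce s(SatV.clause t, SatV.var i) = if b then 0 else 1)
    (hprop : ∀ (t : Fin m) (i : Fin n) (b : Bool), (i, b) ∈ C t →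
      ce s(SatV.clause t, SatV.var i) ≠ cv (SatV.clause t) ∧
      ce s(SatV.clause t, SatV.var i) ≠ cv (SatV.var i))
    (hQ : ∀ t : Fin m, TotalRainbowKConnectedPair (satGraph C) cv ce k
      SatV.s (SatV.clause t)) :
    (∀ t : Fin m, ∃ i : Fin n, (∃ b, (i, b) ∈ C t) ∧
      ∃ p : (satGraph C).Walk SatV.s (SatV.clause t),
        p.support = [SatV.s, SatV.var i, SatV.clause t] ∧
        IsTotalRainbowPath cv ce p) ∧
    (∃ a : Fin n → Bool, ∀ t : Fin m, ∃ i : Fin n, ∃ b : Bool,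
      (i, b) ∈ C t ∧ a i = b ∧
      ∃ p : (satGraph C).Walk SatV.s (SatV.clause t),
        p.support = [SatV.s, SatV.var i, SatV.clause t] ∧
        IsTotalRainbowPath cv ce p) := by
  have hpath := fun t ↦ exists_isTotalRainbowPath_var hk (hQ t)
  refine ⟨fun t ↦ ?_, fun i ↦ decide (ce s(SatV.s, SatV.var i) = 1 ∨ cv (SatV.var i) = 1),
    fun t ↦ ?_⟩
  · obtain ⟨i, b, hb, hp⟩ := hpath t
    exact ⟨i, ⟨b, hb⟩, hp⟩
  · obtain ⟨i, b, hb, p, hs, hp⟩ := hpath t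
    refine ⟨i, b, hb, ?_, p, hs, hp⟩
    have hc := hp.colors_ne hs
    rw [Sym2.eq_swap (a := SatV.var i), hce₁ t i b hb] at hc
    beta_reduce
    generalize ce s(SatV.s, SatV.var i) = x at hc ⊢
    generalize cv (SatV.var i) = y at hc ⊢
    clear hp hs p hb
    revert b x y
    decide

end Paper
end

section
/- Let G be an ℓ-connected graph with ℓ ≥ 1 and let k be an integer with 1 ≤ k ≤ ℓ. If rvc_k(G) ≥ 2, then trc_k(G) ≥ 5. -/
open SimpleGraph

namespace Paper

variable {V : Type*}

theorem internalSupport_length {V : Type*} {G : SimpleGraph V} {u v : V} (p : G.Walk u v) :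
    (internalSupport p).length = p.length - 1 := by
  simp [internalSupport]

theorem internalSupport_nodup {V : Type*} {G : SimpleGraph V} {u v : V} {p : G.Walk u v}
    (hp : p.IsPath) : (internalSupport p).Nodup :=
  hp.support_nodup.sublist ((List.dropLast_sublist _).trans (List.tail_sublist _))

/-- A total coloring giving distinct colors to distinct vertices and edges makes every path
total rainbow. -/
theorem isTotalRainbowPath_of_injective {V α : Type*} {G : SimpleGraph V} {c : V ⊕ Sym2 V → α}
    (hc : Function.Injective c) {u v : V} {p : G.Walk u v} (hp : p.IsPath) :
    IsTotalRainbowPath (c ∘ Sum.inl) (c ∘ Sum.inr) p := by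
  refine ⟨hp, List.nodup_append'.2
    ⟨hp.isTrail.edges_nodup.map (hc.comp Sum.inr_injective),
      (internalSupport_nodup hp).map (hc.comp Sum.inl_injective), ?_⟩⟩
  intro x hx hy
  obtain ⟨a, -, rfl⟩ := List.mem_map.1 hx
  obtain ⟨b, -, hb⟩ := List.mem_map.1 hy
  exact Sum.inl_ne_inr (hc hb)

/-- A total rainbow path of length `m` uses `2 * m - 1` colors. -/
theorem IsTotalRainbowPath.length_add_le {V : Type*} {G : SimpleGraph V} {t : ℕ}
    {cv : V → Fin t} {ce : Sym2 V → Fin t} {u v : V} {p : G.Walk u v}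
    (hp : IsTotalRainbowPath cv ce p) : p.length + (p.length - 1) ≤ t := by
  simpa [internalSupport_length] using hp.2.length_le_card

/-- A path with at most one internal vertex is vertex-rainbow under any coloring. -/
theorem isVertexRainbowPath_of_length_le_two {V α : Type*} {G : SimpleGraph V} (c : V → α)
    {u v : V} {p : G.Walk u v} (hp : p.IsPath) (hlen : p.length ≤ 2) :
    IsVertexRainbowPath c p := by
  refine ⟨hp, List.nodup_iff_injective_get.2 fun i j _ => Fin.ext ?_⟩
  have hi := i.isLt
  have hj := j.isLt
  simp only [List.length_map, internalSupport_length] at hi hj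
  omega

/-- Let `G` be an `ℓ`-connected graph with `ℓ ≥ 1` and let `k` be an
integer with `1 ≤ k ≤ ℓ`. If `rvc_k(G) ≥ 2`, then `trc_k(G) ≥ 5`. -/
theorem trcK_ge_five_of_rvcK_ge_two {V : Type*} [Fintype V] (G : SimpleGraph V) (l k : ℕ)
    (hl : 1 ≤ l) (hconn : IsLConnected G l) (hk : 1 ≤ k) (hkl : k ≤ l)
    (hrvc : 2 ≤ rvcK G k) :
    5 ≤ trcK G k := by
  have hne : {t | ∃ c : V → Fin t, VertexRainbowKConnected G c k}.Nonempty :=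
    Nat.nonempty_of_pos_sInf (Nat.zero_lt_of_lt hrvc)
  obtain ⟨_, c, hc⟩ := hne
  have hne' : {t | ∃ (cv : V → Fin t) (ce : Sym2 V → Fin t),
      TotalRainbowKConnected G cv ce k}.Nonempty := by
    have e := Finite.equivFin (V ⊕ Sym2 V)
    refine ⟨_, e ∘ Sum.inl, e ∘ Sum.inr, fun u v huv => ?_⟩
    obtain ⟨P, hP, hdisj⟩ := hc u v huv
    exact ⟨P, fun i => isTotalRainbowPath_of_injective e.injective (hP i).1, hdisj⟩
  obtain ⟨cv, ce, htot⟩ := Nat.sInf_mem hne'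
  by_contra! hlt
  have hone : rvcK G k ≤ 1 := by
    refine Nat.sInf_le ⟨fun _ => 0, fun u v huv => ?_⟩
    obtain ⟨P, hP, hdisj⟩ := htot u v huv
    refine ⟨P, fun i => isVertexRainbowPath_of_length_le_two _ (hP i).1 ?_, hdisj⟩
    have hcolors : _ ≤ trcK G k := (hP i).length_add_le
    omega
  omega

end Paper
end
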